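/- Let F be a free group and H a finitely generated subgroup of F of infinite index. Then there exist a normal subgroup C of F of finite index and a nontrivial normal subgroup L of C such that L ∩ H = {1}. -/

import Mathlib

/-- The image of a free basis generates the group. -/
theorem FreeGroupBasis.closure_range_eq_top {ι G : Type*} [Group G] (b : FreeGroupBasis ι G) :
    Subgroup.closure (Set.range b) = ⊤ := by
  have h : Set.range b = b.repr.symm.toMonoidHom '' Set.range FreeGroup.of := by
    rw [← Set.range_comp]; rfl
  rw [h, ← MonoidHom.map_closure, FreeGroup.closure_range_of, ← MonoidHom.range_eq_map,
    MonoidHom.range_eq_top]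
  exact b.repr.symm.surjective

theorem IsFreeGroup.isMulTorsionFree (F : Type*) [Group F] [IsFreeGroup F] :
    IsMulTorsionFree F :=
  (IsFreeGroup.mulEquiv F).symm.injective.isMulTorsionFree
    (IsFreeGroup.mulEquiv F).symm.toMonoidHom

namespace Subgroup

variable {F : Type*} [Group F] {H : Subgroup F}

/-- A homomorphism `Φ` to the wreath product of `H` by the permutations of a set `V` of cosets
*tracks* `g` at the coset `q ∈ V` if `Φ g` moves `q` to `g • q ∈ V`, with `H`-component the element
of `H` by which `g` differs from the chosen coset representatives `s`. -/
def Tracks (s : F ⧸ H → F) (V : Finset (F ⧸ H))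
    (Φ : F →* (V → H) ⋊[mulAutArrow] Equiv.Perm V) (g : F) (q : F ⧸ H) : Prop :=
  ∃ (hq : q ∈ V) (hgq : g • q ∈ V), (Φ g).right ⟨q, hq⟩ = ⟨g • q, hgq⟩ ∧
    ((Φ g).left ⟨g • q, hgq⟩ : F) = (s (g • q))⁻¹ * g * s q

section Tracks

variable {s : F ⧸ H → F} {V : Finset (F ⧸ H)}
  {Φ : F →* (V → H) ⋊[mulAutArrow] Equiv.Perm V} {g g' : F} {q : F ⧸ H}

theorem Tracks.one (hq : q ∈ V) : Tracks s V Φ 1 q := by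
  refine ⟨hq, by simpa using hq, ?_, ?_⟩ <;> simp

theorem Tracks.mul (h : Tracks s V Φ g (g' • q)) (h' : Tracks s V Φ g' q) :
    Tracks s V Φ (g * g') q := by
  obtain ⟨_, h₂, hr, hl⟩ := h
  obtain ⟨hq', _, hr', hl'⟩ := h'
  simp only [← mul_smul] at h₂ hr hl
  refine ⟨hq', h₂, ?_, ?_⟩
  · simp [hr', hr]
  · have key : (Φ g).right⁻¹ ⟨(g * g') • q, h₂⟩ = ⟨g' • q, ‹_›⟩ := by
      rw [Equiv.Perm.inv_eq_iff_eq, hr]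
    simp only [map_mul, SemidirectProduct.mul_left, Pi.mul_apply, Subgroup.coe_mul, hl]
    change _ * (((Φ g').left ((Φ g).right⁻¹ _) : H) : F) = _
    rw [key, hl']
    group

theorem Tracks.inv (h : Tracks s V Φ g q) : Tracks s V Φ g⁻¹ (g • q) := by
  obtain ⟨hq, hgq, hr, hl⟩ := h
  refine ⟨hgq, by simpa using hq, ?_, ?_⟩
  · simp only [map_inv, SemidirectProduct.inv_right, Equiv.Perm.inv_eq_iff_eq, inv_smul_smul, hr]
  · simp only [map_inv, SemidirectProduct.inv_left, inv_smul_smul]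
    change (((Φ g).left ((Φ g).right⁻¹⁻¹ _))⁻¹ : F) = _
    rw [inv_inv, hr, hl]
    group

/-- If `Φ` tracks the generators within `V`, then it tracks a given element as soon as `V` contains
a suitable finite set of cosets. -/
theorem exists_finset_forall_tracks (s : F ⧸ H → F) {S : Set F} (hS : closure S = ⊤) (g : F)
    (q : F ⧸ H) :
    ∃ V₀ : Finset (F ⧸ H), ∀ V : Finset (F ⧸ H), V₀ ⊆ V →
      ∀ Φ : F →* (V → H) ⋊[mulAutArrow] Equiv.Perm V,
        (∀ a ∈ S, ∀ r ∈ V, a • r ∈ V → Tracks s V Φ a r) → Tracks s V Φ g q := by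
  classical
  have hg : g ∈ closure S := hS ▸ mem_top g
  induction hg using closure_induction generalizing q with
  | mem a ha =>
    refine ⟨{q, a • q}, fun V hV Φ hΦ => hΦ a ha q (hV ?_) (hV ?_)⟩ <;> simp
  | one => exact ⟨{q}, fun V hV Φ _ => .one (hV (by simp))⟩
  | mul x y _ _ hx hy =>
    obtain ⟨V₁, h₁⟩ := hx (y • q)
    obtain ⟨V₂, h₂⟩ := hy q
    exact ⟨V₁ ∪ V₂, fun V hV Φ hΦ => (h₁ V (Finset.union_subset_left hV) Φ hΦ).mul
      (h₂ V (Finset.union_subset_right hV) Φ hΦ)⟩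
  | inv x _ hx =>
    obtain ⟨V₁, h₁⟩ := hx (x⁻¹ • q)
    exact ⟨V₁, fun V hV Φ hΦ => by simpa using (h₁ V hV Φ hΦ).inv⟩

/-- In a free group, partial translations of a finite set of cosets by basis elements extend to a
homomorphism to the wreath product. -/
theorem exists_tracks_basis {ι : Type*} (b : FreeGroupBasis ι F) (s : F ⧸ H → F)
    (hs : ∀ q, (s q : F ⧸ H) = q) (V : Finset (F ⧸ H)) :
    ∃ Φ : F →* (V → H) ⋊[mulAutArrow] Equiv.Perm V,
      ∀ a ∈ Set.range b, ∀ r ∈ V, a • r ∈ V → Tracks s V Φ a r := by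
  classical
  have hσ (i : ι) : ∃ σ : Equiv.Perm V, ∀ r : V, b i • (r : F ⧸ H) ∈ V →
      (σ r : F ⧸ H) = b i • (r : F ⧸ H) :=
    Set.MapsTo.exists_equiv_extend_of_card_eq (s := {r : V | b i • (r : F ⧸ H) ∈ V})
      (f := fun r : V => b i • (r : F ⧸ H)) (Fintype.card_coe V) (fun _ hr => hr)
      (fun _ _ _ _ h => Subtype.ext (MulAction.injective (b i) h))
  choose σ hσ using hσ
  let c (i : ι) (w : V) : H :=
    if h : (s w)⁻¹ * b i * s ((σ i).symm w : V) ∈ H then ⟨_, h⟩ else 1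
  have hΦ (i : ι) : b.lift (fun i => (⟨c i, σ i⟩ : (V → H) ⋊[mulAutArrow] Equiv.Perm V)) (b i) =
      ⟨c i, σ i⟩ := by simp
  refine ⟨b.lift fun i => ⟨c i, σ i⟩, ?_⟩
  rintro _ ⟨i, rfl⟩ r hr hir
  have hir' : σ i ⟨r, hr⟩ = ⟨b i • r, hir⟩ := Subtype.ext (hσ i ⟨r, hr⟩ hir)
  have key : (σ i).symm ⟨b i • r, hir⟩ = ⟨r, hr⟩ := by rw [Equiv.symm_apply_eq, hir']
  have hmem : (s (b i • r))⁻¹ * b i * s r ∈ H := by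
    rw [mul_assoc, ← QuotientGroup.eq, hs, ← smul_eq_mul, ← MulAction.Quotient.smul_coe, hs]
  refine ⟨hr, hir, ?_, ?_⟩
  · rw [hΦ, hir']
  · rw [hΦ]
    simp [c, key, hmem]

end Tracks

/-- **Marshall Hall's theorem**, retract form: a finitely generated subgroup of a free group is a
retract of a subgroup of finite index. -/
theorem FG.exists_finiteIndex_retraction [IsFreeGroup F] (hfg : H.FG) :
    ∃ (K : Subgroup F) (hHK : H ≤ K) (ρ : K →* H), K.FiniteIndex ∧
      ∀ h : H, ρ (inclusion hHK h) = h := by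
  classical
  obtain ⟨s, hs, hs1⟩ : ∃ s : F ⧸ H → F, (∀ q, (s q : F ⧸ H) = q) ∧ s (1 : F) = 1 := by
    refine ⟨Function.update Quotient.out ((1 : F) : F ⧸ H) 1, fun q => ?_, by simp⟩
    obtain rfl | hq := eq_or_ne q ((1 : F) : F ⧸ H)
    · simp
    · simp [hq]
  let b := IsFreeGroup.basis F
  obtain ⟨T, hT⟩ := hfg
  choose V₀ hV₀ using fun g : F =>
    exists_finset_forall_tracks s b.closure_range_eq_top g ((1 : F) : F ⧸ H)
  let V : Finset (F ⧸ H) := insert ((1 : F) : F ⧸ H) (T.biUnion V₀)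
  obtain ⟨Φ, hΦ⟩ := exists_tracks_basis b s hs V
  have h1V : ((1 : F) : F ⧸ H) ∈ V := Finset.mem_insert_self _ _
  have hsmul {h : F} (hh : h ∈ H) : h • ((1 : F) : F ⧸ H) = (1 : F) := by
    rw [MulAction.Quotient.smul_coe, QuotientGroup.eq]
    simpa using hh
  have htracks {h : F} (hh : h ∈ H) : Tracks s V Φ h (1 : F) := by
    have hh' : h ∈ closure (T : Set F) := hT ▸ hh
    induction hh' using closure_induction with
    | mem t ht =>
      exact hV₀ t V ((Finset.subset_biUnion_of_mem V₀ ht).trans (Finset.subset_insert _ _)) Φ hΦ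
    | one => exact .one h1V
    | mul x y hx hy ihx ihy =>
      rw [hT] at hx hy
      exact Tracks.mul (by rw [hsmul hy]; exact ihx hx) (ihy hy)
    | inv x hx ihx =>
      rw [hT] at hx
      simpa only [hsmul hx] using (ihx hx).inv
  let v₀ : V := ⟨_, h1V⟩
  let K : Subgroup F :=
    (MulAction.stabilizer (Equiv.Perm V) v₀).comap (SemidirectProduct.rightHom.comp Φ)
  have hK {k : F} : k ∈ K ↔ (Φ k).right v₀ = v₀ := Iff.rfl
  have hright {h : F} (hh : h ∈ H) : (Φ h).right v₀ = v₀ := by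
    obtain ⟨_, _, hr, _⟩ := htracks hh
    exact hr.trans (Subtype.ext (hsmul hh))
  have hleft {h : F} (hh : h ∈ H) : ((Φ h).left v₀ : F) = h := by
    obtain ⟨_, _, _, hl⟩ := htracks hh
    simpa [hsmul hh, hs1] using hl
  refine ⟨K, fun h hh => hright hh, MonoidHom.mk' (fun k => (Φ k).left v₀) ?_, ?_,
    fun h => Subtype.ext (hleft h.2)⟩
  · intro k k'
    have hk : (Φ k).right⁻¹ v₀ = v₀ := by rw [Equiv.Perm.inv_eq_iff_eq, hK.1 k.2]
    simp only [coe_mul, map_mul, SemidirectProduct.mul_left, Pi.mul_apply]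
    change _ * (Φ k').left ((Φ k).right⁻¹ v₀) = _
    rw [hk]
  · exact ⟨by rw [index_comap]; exact isFiniteRelIndex_of_finiteIndex.relIndex_ne_zero⟩

end Subgroup

/-- For a finitely generated subgroup `H` of infinite index in a free group `F`,
there are a finite-index normal subgroup `C` of `F` and a nontrivial normal
subgroup `L` of `C` with `L ∩ H = {1}`. -/
theorem stmt_7 {F : Type*} [Group F] [IsFreeGroup F] (H : Subgroup F)
    (hfg : H.FG) (hinf : Infinite (F ⧸ H)) :
    ∃ C : Subgroup F, C.Normal ∧ C.FiniteIndex ∧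
      ∃ L : Subgroup F, L ≤ C ∧ (L.subgroupOf C).Normal ∧ L ≠ ⊥ ∧ L ⊓ H = ⊥ := by
  have := IsFreeGroup.isMulTorsionFree F
  obtain ⟨K, hHK, ρ, hKfin, hρ⟩ := hfg.exists_finiteIndex_retraction
  refine ⟨K.normalCore, inferInstance, inferInstance,
    ρ.ker.map K.subtype ⊓ K.normalCore, inf_le_right, ?_, ?_, ?_⟩
  · refine ⟨fun n hn g => ?_⟩
    rw [Subgroup.mem_subgroupOf] at hn ⊢
    obtain ⟨⟨x, hx, hxn⟩, _⟩ := hn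
    refine ⟨⟨⟨g, K.normalCore_le g.2⟩ * x * ⟨g, K.normalCore_le g.2⟩⁻¹,
      ρ.normal_ker.conj_mem x hx _, ?_⟩, (g * n * g⁻¹).2⟩
    simp [← hxn]
  · intro hbot
    obtain ⟨k, hkK, hkH⟩ : ∃ k ∈ K, k ∉ H := by
      by_contra! hle
      have : H.FiniteIndex := Subgroup.finiteIndex_of_le (H := K) hle
      exact not_finite (F ⧸ H)
    let x : K := ⟨k, hkK⟩ * (Subgroup.inclusion hHK (ρ ⟨k, hkK⟩))⁻¹
    have hx : x ∈ ρ.ker := by simp [x, MonoidHom.mem_ker, hρ]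
    obtain ⟨n, hn, -, hnC⟩ :=
      Subgroup.exists_pow_mem_of_index_ne_zero (H := K.normalCore)
        Subgroup.FiniteIndex.index_ne_zero (x : F)
    have hxn : (x : F) ^ n ∈ ρ.ker.map K.subtype ⊓ K.normalCore :=
      ⟨⟨x ^ n, pow_mem hx n, by simp⟩, hnC⟩
    rw [hbot, Subgroup.mem_bot, pow_eq_one_iff_left hn.ne'] at hxn
    apply hkH
    have hk : k = ρ ⟨k, hkK⟩ := by
      simpa [x, mul_inv_eq_one] using hxn
    rw [hk]
    exact (ρ ⟨k, hkK⟩).2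
  · rw [eq_bot_iff]
    rintro _ ⟨⟨⟨x, hx, rfl⟩, -⟩, hxH⟩
    have h := hρ ⟨x, hxH⟩
    have hx' : Subgroup.inclusion hHK ⟨x, hxH⟩ = x := rfl
    rw [hx', MonoidHom.mem_ker.1 hx] at h
    exact (congrArg Subtype.val h).symm
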